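/- Let Δ be a pure d-dimensional simplicial complex with j facets such that (a) the facet-ridge graph of Δ (vertices the facets of Δ, with an edge between two facets whose intersection has exactly d elements) is connected, and (b) the f-polynomial of Δ equals (1+t)^d (1 + j t). Then Δ is a stacked complex. -/

import Mathlib

open Finset Polynomial

/-- A (finite) simplicial complex: a nonempty collection of finite sets closed
under taking subsets. -/
def IsComplex {V : Type*} [DecidableEq V] (Δ : Finset (Finset V)) : Prop :=
  Δ.Nonempty ∧ ∀ σ ∈ Δ, ∀ τ, τ ⊆ σ → τ ∈ Δ

/-- The facets (maximal faces) of `Δ`. -/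
def facets {V : Type*} [DecidableEq V] (Δ : Finset (Finset V)) : Finset (Finset V) :=
  Δ.filter fun F => ∀ G ∈ Δ, F ⊆ G → F = G

/-- The facet-ridge graph of a pure `d`-dimensional complex: vertices are the facets,
two facets being adjacent when their intersection has exactly `d` elements. -/
def ridgeGraph {V : Type*} [DecidableEq V] (Δ : Finset (Finset V)) (d : ℕ) :
    SimpleGraph {F // F ∈ facets Δ} :=
  SimpleGraph.fromRel fun F G => ((F : Finset V) ∩ (G : Finset V)).card = d

/-- The complex generated by a list of faces: all subsets of the members of `L`. -/
def genL {V : Type*} [DecidableEq V] (L : List (Finset V)) : Finset (Finset V) :=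
  L.toFinset.biUnion Finset.powerset

/-- `L = [F_1, …, F_j]` is a stacked shelling of a pure `d`-dimensional complex:
the `F_l` are distinct faces of cardinality `d + 1` and, for each `1 ≤ i ≤ j - 1`,
`⟨F_1, …, F_i⟩ ∩ ⟨F_{i+1}⟩` is the powerset of some `d`-element subset of `F_{i+1}`. -/
def IsStackedShelling {V : Type*} [DecidableEq V] (d : ℕ) (L : List (Finset V)) : Prop :=
  L ≠ [] ∧ L.Nodup ∧ (∀ F ∈ L, F.card = d + 1) ∧
  ∀ i : Fin L.length, 0 < i.1 →
    ∃ R ⊆ L.get i, R.card = d ∧ genL (L.take i.1) ∩ (L.get i).powerset = R.powerset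

/-- A stacked simplicial complex of dimension `d`: one generated by a stacked shelling. -/
def IsStacked {V : Type*} [DecidableEq V] (Δ : Finset (Finset V)) (d : ℕ) : Prop :=
  ∃ L : List (Finset V), IsStackedShelling d L ∧ Δ = genL L

/-- Every face of a finite complex lies in a facet. -/
theorem exists_facet_superset {V : Type*} [DecidableEq V] {Δ : Finset (Finset V)}
    {σ : Finset V} (hσ : σ ∈ Δ) : ∃ F ∈ facets Δ, σ ⊆ F := by
  obtain ⟨F, hσF, hF⟩ := Δ.exists_le_maximal hσ
  refine ⟨F, ?_, hσF⟩
  rw [facets, mem_filter]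
  exact ⟨hF.prop, fun G hG hFG => hF.eq_of_le hG hFG⟩

theorem mem_genL {V : Type*} [DecidableEq V] {L : List (Finset V)} {σ : Finset V} :
    σ ∈ genL L ↔ ∃ F ∈ L, σ ⊆ F := by
  simp [genL]

/-- Attaching a new facet along a single ridge extends a stacked shelling. -/
theorem IsStackedShelling.concat {V : Type*} [DecidableEq V] {d : ℕ} {L : List (Finset V)}
    {F R : Finset V} (hL : IsStackedShelling d L) (hFL : F ∉ L) (hF : F.card = d + 1)
    (hRF : R ⊆ F) (hR : R.card = d) (h : genL L ∩ F.powerset = R.powerset) :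
    IsStackedShelling d (L ++ [F]) := by
  obtain ⟨-, hnd, hcard, hstep⟩ := hL
  refine ⟨by simp, ?_, ?_, ?_⟩
  · simpa only [List.concat_eq_append] using hnd.concat hFL
  · intro G hG
    rcases List.mem_append.1 hG with hG | hG
    · exact hcard G hG
    · rwa [List.mem_singleton.1 hG]
  · rintro ⟨i, hi⟩ hpos
    have hi' : i < L.length + 1 := by simpa using hi
    rcases Nat.lt_succ_iff_lt_or_eq.1 hi' with hlt | rfl
    · have := hstep ⟨i, hlt⟩ hpos
      simpa [List.getElem_append_left hlt, List.take_append_of_le_length hlt.le] using this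
    · exact ⟨R, by simpa using hRF, hR, by simpa using h⟩

/-- Some facet outside a nonempty proper list of facets is adjacent to one inside it. -/
theorem exists_adjacent_facet_notMem {V : Type*} [DecidableEq V] {Δ : Finset (Finset V)} {d : ℕ}
    (hconn : (ridgeGraph Δ d).Connected) {L : List (Finset V)} (hL : L ≠ [])
    (hLΔ : ∀ F ∈ L, F ∈ facets Δ) (hlt : L.length < (facets Δ).card) :
    ∃ G ∈ L, ∃ F ∈ facets Δ, F ∉ L ∧ (F ∩ G).card = d := by
  obtain ⟨A, hA⟩ := List.exists_mem_of_ne_nil L hL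
  obtain ⟨B, hB, hBL⟩ := exists_mem_notMem_of_card_lt_card
    ((List.toFinset_card_le L).trans_lt hlt)
  obtain ⟨p⟩ := hconn.preconnected ⟨A, hLΔ A hA⟩ ⟨B, hB⟩
  obtain ⟨e, -, he, he'⟩ := p.exists_boundary_dart {x | x.1 ∈ L} hA (by simpa using hBL)
  refine ⟨e.fst.1, he, e.snd.1, e.snd.2, he', ?_⟩
  rcases ((SimpleGraph.fromRel_adj _ _ _).1 e.adj).2 with h | h
  · rwa [inter_comm]
  · exact h

/-- Listing `n` facets along the facet-ridge graph covers at most `d + n` vertices, and the list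
is a stacked shelling in the case of equality. -/
theorem exists_facet_list {V : Type*} [DecidableEq V] {Δ : Finset (Finset V)} {d : ℕ}
    (hpure : ∀ F ∈ facets Δ, F.card = d + 1) (hconn : (ridgeGraph Δ d).Connected) (n : ℕ)
    (hn : n + 1 ≤ (facets Δ).card) :
    ∃ L : List (Finset V), L.length = n + 1 ∧ L.Nodup ∧ (∀ F ∈ L, F ∈ facets Δ) ∧
      (L.toFinset.biUnion id).card ≤ d + (n + 1) ∧
      ((L.toFinset.biUnion id).card = d + (n + 1) → IsStackedShelling d L) := by
  induction n with
  | zero =>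
    obtain ⟨F, hF⟩ := hconn.nonempty
    refine ⟨[F], by simp, by simp, by simpa using hF, by simp [hpure F hF], fun _ => ?_⟩
    refine ⟨by simp, by simp, by simpa using hpure F hF, ?_⟩
    rintro ⟨i, hi⟩ hpos
    simp only [List.length_singleton] at hi
    exact absurd hpos (by simp; omega)
  | succ n ih =>
    obtain ⟨L, hlen, hnd, hLΔ, hle, hstacked⟩ := ih (by omega)
    obtain ⟨G, hG, F, hF, hFL, hFG⟩ := exists_adjacent_facet_notMem hconn
      (List.ne_nil_of_length_eq_add_one hlen) hLΔ (by omega)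
    set U := L.toFinset.biUnion id with hU
    have hGU : G ⊆ U := subset_biUnion_of_mem id (List.mem_toFinset.2 hG)
    have hunion : (L ++ [F]).toFinset.biUnion id = U ∪ F := by
      simp [hU, List.toFinset_append, union_comm]
    have hsub : F ∩ G ⊆ F ∩ U := inter_subset_inter_left hGU
    have hsubcard := card_le_card hsub
    have hcard := card_union_add_card_inter U F
    rw [inter_comm U F, hpure F hF] at hcard
    refine ⟨L ++ [F], by simp [hlen], ?_, ?_, ?_, fun heq => ?_⟩
    · simpa only [List.concat_eq_append] using hnd.concat hFL
    · intro H hH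
      rcases List.mem_append.1 hH with hH | hH
      · exact hLΔ H hH
      · rwa [List.mem_singleton.1 hH]
    · rw [hunion]
      omega
    · rw [hunion] at heq
      have hR : F ∩ G = F ∩ U := eq_of_subset_of_card_le hsub (by omega)
      refine (hstacked (by omega)).concat hFL (hpure F hF) inter_subset_left hFG ?_
      ext σ
      rw [mem_inter, mem_genL, mem_powerset, mem_powerset]
      constructor
      · rintro ⟨⟨H, hH, hσH⟩, hσF⟩
        rw [hR]
        exact subset_inter hσF
          (hσH.trans (subset_biUnion_of_mem id (List.mem_toFinset.2 hH)))
      · intro hσ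
        exact ⟨⟨G, hG, hσ.trans inter_subset_right⟩, hσ.trans inter_subset_left⟩

/-- The linear coefficient of the f-polynomial counts the vertices. -/
theorem card_vertices_of_f_polynomial {V : Type*} {Δ : Finset (Finset V)} {d j : ℕ}
    (hf : (∑ σ ∈ Δ, (X : Polynomial ℤ) ^ σ.card)
        = (1 + X) ^ d * (1 + (j : Polynomial ℤ) * X)) :
    (Δ.filter fun σ => σ.card = 1).card = d + j := by
  have h := congrArg (fun p : Polynomial ℤ => p.coeff 1) hf
  have hr : ((1 + X) ^ d * (1 + (j : Polynomial ℤ) * X)).coeff 1 = (d : ℤ) + j := by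
    rw [mul_add, mul_one, ← mul_assoc, coeff_add, coeff_mul_X, coeff_mul_natCast,
      coeff_one_add_X_pow, coeff_one_add_X_pow]
    simp
  simp only [finsetSum_coeff, coeff_X_pow, hr, eq_comm (a := 1), sum_boole] at h
  exact_mod_cast h

/-- A pure `d`-dimensional complex with `j` facets whose facet-ridge graph is connected
and whose f-polynomial equals `(1+t)^d (1 + j t)` is a stacked complex. -/
theorem stacked_of_connected_ridge_graph_and_f_polynomial
    {V : Type*} [DecidableEq V] (Δ : Finset (Finset V)) (d j : ℕ)
    (hΔ : IsComplex Δ)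
    (hpure : ∀ F ∈ facets Δ, F.card = d + 1)
    (hj : (facets Δ).card = j)
    (hconn : (ridgeGraph Δ d).Connected)
    (hf : (∑ σ ∈ Δ, (X : Polynomial ℤ) ^ σ.card)
        = (1 + X) ^ d * (1 + (j : Polynomial ℤ) * X)) :
    IsStacked Δ d := by
  subst hj
  obtain ⟨F₀, hF₀⟩ := hconn.nonempty
  obtain ⟨n, hn⟩ := Nat.exists_eq_add_one.2 (card_pos.2 ⟨F₀, hF₀⟩)
  obtain ⟨L, hlen, hnd, hLΔ, hle, hstacked⟩ := exists_facet_list hpure hconn n hn.ge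
  have hLeq : L.toFinset = facets Δ := by
    refine eq_of_subset_of_card_le (fun F hF => hLΔ F (List.mem_toFinset.1 hF)) ?_
    rw [List.toFinset_card_of_nodup hnd, hlen, hn]
  have hmem : ∀ σ ∈ Δ, ∃ F ∈ L, σ ⊆ F := fun σ hσ => by
    obtain ⟨F, hF, hσF⟩ := exists_facet_superset hσ
    exact ⟨F, List.mem_toFinset.1 (hLeq ▸ hF), hσF⟩
  have hvert : (Δ.filter fun σ => σ.card = 1) ⊆ (L.toFinset.biUnion id).powersetCard 1 := by
    intro σ hσ
    obtain ⟨hσΔ, hσ1⟩ := mem_filter.1 hσ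
    obtain ⟨F, hF, hσF⟩ := hmem σ hσΔ
    exact mem_powersetCard.2
      ⟨hσF.trans (subset_biUnion_of_mem id (List.mem_toFinset.2 hF)), hσ1⟩
  have hge := card_le_card hvert
  rw [card_vertices_of_f_polynomial hf, card_powersetCard, Nat.choose_one_right, hn] at hge
  refine ⟨L, hstacked (le_antisymm hle hge), ?_⟩
  ext σ
  rw [mem_genL]
  exact ⟨hmem σ, fun ⟨F, hF, hσF⟩ => hΔ.2 F (mem_filter.1 (hLΔ F hF)).1 σ hσF⟩
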